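/- Let $N\ge 2$, $\triangle=x\frac{d^2}{dx^2}+\frac N2\frac{d}{dx}$, let $F(x,y)$ be a smooth function on $[0,1]\times\mathbb{R}$ and $M>0$. Then for each positive integer $m$ there is $C>0$ such that for all $y\in C^\infty([0,1])$ with $\|y\|_{L^\infty}\le M$: $\|\triangle^m F(\cdot,y(\cdot))\|_{L^\infty(0,1)}\le C(1+|y|_m)$, where $|y|_m=\sup_{0\le j\le m}\|\triangle^j y\|_{L^\infty}$. -/

import Mathlib

noncomputable def lap (N : ℝ) (y : ℝ → ℝ) : ℝ → ℝ :=
  fun x => x * deriv (deriv y) x + N / 2 * deriv y x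

noncomputable def supNorm (f : ℝ → ℝ) : ℝ :=
  ⨆ x : Set.Icc (0 : ℝ) 1, |f x.1|

open Set Function

/-- The first-order operator `h ↦ r * deriv h + c * h`. -/
noncomputable def eulerOp (c : ℝ) (h : ℝ → ℝ) : ℝ → ℝ := fun r => r * deriv h r + c * h r

theorem contDiff_deriv_top {f : ℝ → ℝ} (hf : ContDiff ℝ (⊤ : ℕ∞) f) :
    ContDiff ℝ (⊤ : ℕ∞) (deriv f) := (contDiff_infty_iff_deriv.1 hf).2

theorem contDiff_iteratedDeriv_top {f : ℝ → ℝ} (hf : ContDiff ℝ (⊤ : ℕ∞) f) (k : ℕ) :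
    ContDiff ℝ (⊤ : ℕ∞) (iteratedDeriv k f) := by
  induction k with
  | zero => simpa using hf
  | succ k ih => rw [iteratedDeriv_succ]; exact contDiff_deriv_top ih

theorem contDiff_lap {N : ℝ} {f : ℝ → ℝ} (hf : ContDiff ℝ (⊤ : ℕ∞) f) :
    ContDiff ℝ (⊤ : ℕ∞) (lap N f) := by
  have h1 := contDiff_deriv_top hf
  have h2 := contDiff_deriv_top h1
  unfold lap
  fun_prop

theorem contDiff_lap_iterate {N : ℝ} {f : ℝ → ℝ} (hf : ContDiff ℝ (⊤ : ℕ∞) f) (m : ℕ) :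
    ContDiff ℝ (⊤ : ℕ∞) ((lap N)^[m] f) := by
  induction m generalizing f with
  | zero => simpa using hf
  | succ m ih => exact ih (contDiff_lap hf)

theorem abs_le_supNorm {f : ℝ → ℝ} (hf : Continuous f) {x : ℝ} (hx : x ∈ Icc (0 : ℝ) 1) :
    |f x| ≤ supNorm f := by
  have hb : BddAbove (range fun x : Icc (0 : ℝ) 1 => |f x.1|) :=
    (isCompact_range (by fun_prop)).bddAbove
  exact le_ciSup hb ⟨x, hx⟩

theorem supNorm_le {f : ℝ → ℝ} {B : ℝ} (h : ∀ x ∈ Icc (0 : ℝ) 1, |f x| ≤ B) : supNorm f ≤ B :=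
  haveI : Nonempty (Icc (0 : ℝ) 1) := ⟨⟨0, by simp⟩⟩
  ciSup_le fun x => h x.1 x.2

/-- One-sided maximum principle for `eulerOp c f` on `[0, 1]`. -/
theorem mul_le_of_eulerOp_le {f : ℝ → ℝ} (hf : Differentiable ℝ f) {c B : ℝ} (hc : 0 < c)
    (h : ∀ r ∈ Icc (0 : ℝ) 1, eulerOp c f r ≤ B) {r : ℝ} (hr : r ∈ Icc (0 : ℝ) 1) :
    c * f r ≤ B := by
  obtain ⟨p, hp, hmax⟩ := isCompact_Icc.exists_isMaxOn (nonempty_of_mem hr)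
    hf.continuous.continuousOn
  have hd : 0 ≤ p * deriv f p := by
    rcases hp.1.eq_or_lt with h0 | h0
    · simp [← h0]
    · have hp0 : (0 : ℝ) ∈ Icc (0 : ℝ) 1 := by simp
      have hs : segment ℝ p 0 ⊆ Icc (0 : ℝ) 1 := (convex_Icc 0 1).segment_subset hp hp0
      have := (hmax.localize).hasFDerivWithinAt_nonpos
        ((hf p).hasDerivAt.hasFDerivAt.hasFDerivWithinAt)
        (sub_mem_posTangentConeAt_of_segment_subset hs)
      simp at this
      linarith
  have h1 := h p hp
  have h2 : f r ≤ f p := hmax hr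
  unfold eulerOp at h1
  nlinarith

theorem abs_le_of_eulerOp_le {f : ℝ → ℝ} (hf : Differentiable ℝ f) {c B : ℝ} (hc : 1 ≤ c)
    (h : ∀ r ∈ Icc (0 : ℝ) 1, |eulerOp c f r| ≤ B) {r : ℝ} (hr : r ∈ Icc (0 : ℝ) 1) :
    |f r| ≤ B := by
  have hc0 : 0 < c := by linarith
  have hB : 0 ≤ B := (abs_nonneg _).trans (h r hr)
  have h1 := mul_le_of_eulerOp_le hf hc0 (fun r hr => (le_abs_self _).trans (h r hr)) hr
  have h2 := mul_le_of_eulerOp_le (f := fun r => -f r) (B := B) hf.neg hc0 (fun r hr => by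
    have := (neg_le_abs _).trans (h r hr)
    simp only [eulerOp, deriv.fun_neg] at this ⊢
    linarith) hr
  rw [abs_le]
  constructor <;> nlinarith

theorem iteratedDeriv_eulerOp {h : ℝ → ℝ} (hh : ContDiff ℝ (⊤ : ℕ∞) h) (c : ℝ) (k : ℕ) :
    iteratedDeriv k (eulerOp c h) = eulerOp (c + k) (iteratedDeriv k h) := by
  induction k with
  | zero => simp
  | succ k ih =>
    rw [iteratedDeriv_succ, ih, iteratedDeriv_succ (f := h)]
    have h0 := contDiff_iteratedDeriv_top hh k
    generalize iteratedDeriv k h = f at h0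
    have h1 := contDiff_deriv_top h0
    funext r
    have d0 : HasDerivAt f (deriv f r) r := (h0.differentiable (by simp) r).hasDerivAt
    have d1 : HasDerivAt (deriv f) (deriv (deriv f) r) r :=
      (h1.differentiable (by simp) r).hasDerivAt
    have := (((hasDerivAt_id r).mul d1).add (d0.const_mul (c + k))).deriv
    simp only [eulerOp]
    refine this.trans ?_
    simp
    ring

theorem abs_iteratedDeriv_le_of_eulerOp {h : ℝ → ℝ} (hh : ContDiff ℝ (⊤ : ℕ∞) h) {c B : ℝ}
    (hc : 1 ≤ c) {k : ℕ}
    (hB : ∀ r ∈ Icc (0 : ℝ) 1, |iteratedDeriv k (eulerOp c h) r| ≤ B) {r : ℝ}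
    (hr : r ∈ Icc (0 : ℝ) 1) : |iteratedDeriv k h r| ≤ B := by
  rw [iteratedDeriv_eulerOp hh] at hB
  exact abs_le_of_eulerOp_le ((contDiff_iteratedDeriv_top hh k).differentiable (by simp))
    (le_add_of_le_of_nonneg hc k.cast_nonneg) hB hr

theorem contDiff_comp_sq {y : ℝ → ℝ} (hy : ContDiff ℝ (⊤ : ℕ∞) y) :
    ContDiff ℝ (⊤ : ℕ∞) fun r => y (r ^ 2) := by fun_prop

theorem deriv_comp_sq {y : ℝ → ℝ} (hy : ContDiff ℝ (⊤ : ℕ∞) y) :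
    deriv (fun r => y (r ^ 2)) = fun r => 2 * r * deriv y (r ^ 2) := by
  funext r
  have d0 : HasDerivAt y (deriv y (r ^ 2)) (r ^ 2) :=
    (hy.differentiable (by simp) _).hasDerivAt
  have := (HasDerivAt.comp (h₂ := y) (h := fun r => r ^ 2) r d0 (hasDerivAt_pow 2 r)).deriv
  refine this.trans ?_
  simp
  ring

theorem deriv_deriv_comp_sq {y : ℝ → ℝ} (hy : ContDiff ℝ (⊤ : ℕ∞) y) :
    deriv (deriv fun r => y (r ^ 2)) = fun r => 2 * eulerOp 1 (fun r => deriv y (r ^ 2)) r := by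
  rw [deriv_comp_sq hy]
  funext r
  have d0 : HasDerivAt (fun r => deriv y (r ^ 2)) (deriv (fun r => deriv y (r ^ 2)) r) r :=
    ((contDiff_comp_sq (contDiff_deriv_top hy)).differentiable (by simp) r).hasDerivAt
  have := (((hasDerivAt_id r).const_mul 2).mul d0).deriv
  refine this.trans ?_
  simp [eulerOp]
  ring

theorem lap_comp_sq (N : ℝ) {y : ℝ → ℝ} (hy : ContDiff ℝ (⊤ : ℕ∞) y) :
    (fun r => lap N y (r ^ 2)) = fun r => 2⁻¹ * eulerOp N (fun r => deriv y (r ^ 2)) r := by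
  funext r
  simp only [lap, eulerOp, deriv_comp_sq (contDiff_deriv_top hy)]
  ring

theorem iteratedDeriv_eulerOp_sub {h : ℝ → ℝ} (hh : ContDiff ℝ (⊤ : ℕ∞) h) (N : ℝ) (k : ℕ)
    (r : ℝ) : iteratedDeriv k (eulerOp N h) r =
      iteratedDeriv k (eulerOp 1 h) r + (N - 1) * iteratedDeriv k h r := by
  rw [iteratedDeriv_eulerOp hh, iteratedDeriv_eulerOp hh]
  simp only [eulerOp]
  ring

theorem iteratedDeriv_add_two (k : ℕ) (u : ℝ → ℝ) :
    iteratedDeriv (k + 2) u = iteratedDeriv k (deriv (deriv u)) := by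
  rw [iteratedDeriv_succ', iteratedDeriv_succ']

theorem abs_iteratedDeriv_comp_sq_le {N : ℝ} (hN : 1 ≤ N) {y : ℝ → ℝ}
    (hy : ContDiff ℝ (⊤ : ℕ∞) y) {k : ℕ} {B : ℝ}
    (hB : ∀ r ∈ Icc (0 : ℝ) 1, |iteratedDeriv k (fun r => lap N y (r ^ 2)) r| ≤ B) {r : ℝ}
    (hr : r ∈ Icc (0 : ℝ) 1) : |iteratedDeriv (k + 2) (fun r => y (r ^ 2)) r| ≤ 4 * N * B := by
  have hh := contDiff_comp_sq (contDiff_deriv_top hy)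
  rw [iteratedDeriv_add_two, deriv_deriv_comp_sq hy, iteratedDeriv_const_mul_field]
  rw [lap_comp_sq N hy] at hB
  have hE : ∀ r ∈ Icc (0 : ℝ) 1,
      |iteratedDeriv k (eulerOp N fun r => deriv y (r ^ 2)) r| ≤ 2 * B := fun r hr => by
    have := hB r hr
    rw [iteratedDeriv_const_mul_field, abs_mul, abs_of_pos (by norm_num : (0 : ℝ) < 2⁻¹)] at this
    linarith
  have h1 := abs_le.1 (abs_iteratedDeriv_le_of_eulerOp hh hN hE hr)
  have h2 := abs_le.1 (hE r hr)
  rw [iteratedDeriv_eulerOp_sub hh] at h2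
  rw [abs_le]
  constructor <;> nlinarith

theorem abs_iteratedDeriv_lap_comp_sq_le {N : ℝ} (hN : 1 ≤ N) {y : ℝ → ℝ}
    (hy : ContDiff ℝ (⊤ : ℕ∞) y) {k : ℕ} {B : ℝ}
    (hB : ∀ r ∈ Icc (0 : ℝ) 1, |iteratedDeriv (k + 2) (fun r => y (r ^ 2)) r| ≤ B) {r : ℝ}
    (hr : r ∈ Icc (0 : ℝ) 1) : |iteratedDeriv k (fun r => lap N y (r ^ 2)) r| ≤ N * B := by
  have hh := contDiff_comp_sq (contDiff_deriv_top hy)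
  rw [lap_comp_sq N hy, iteratedDeriv_const_mul_field]
  rw [iteratedDeriv_add_two, deriv_deriv_comp_sq hy] at hB
  have hE : ∀ r ∈ Icc (0 : ℝ) 1,
      |iteratedDeriv k (eulerOp 1 fun r => deriv y (r ^ 2)) r| ≤ B / 2 := fun r hr => by
    have := hB r hr
    rw [iteratedDeriv_const_mul_field, abs_mul, abs_of_pos (by norm_num : (0 : ℝ) < 2)] at this
    linarith
  have h1 := abs_le.1 (abs_iteratedDeriv_le_of_eulerOp hh le_rfl hE hr)
  have h2 := abs_le.1 (hE r hr)
  rw [iteratedDeriv_eulerOp_sub hh]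
  rw [abs_le]
  constructor <;> nlinarith

theorem abs_iteratedDeriv_comp_sq_le_of_iterate {N : ℝ} (hN : 1 ≤ N) (m : ℕ) {y : ℝ → ℝ}
    (hy : ContDiff ℝ (⊤ : ℕ∞) y) {k : ℕ} {B : ℝ}
    (hB : ∀ r ∈ Icc (0 : ℝ) 1, |iteratedDeriv k (fun r => (lap N)^[m] y (r ^ 2)) r| ≤ B) {r : ℝ}
    (hr : r ∈ Icc (0 : ℝ) 1) :
    |iteratedDeriv (k + 2 * m) (fun r => y (r ^ 2)) r| ≤ (4 * N) ^ m * B := by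
  induction m generalizing y r with
  | zero => simpa using hB r hr
  | succ m ih =>
    have := abs_iteratedDeriv_comp_sq_le hN hy (fun r hr => ih (contDiff_lap hy) hB hr) hr
    rw [show k + 2 * (m + 1) = k + 2 * m + 2 by ring, pow_succ']
    linarith

theorem abs_iteratedDeriv_lap_iterate_comp_sq_le {N : ℝ} (hN : 1 ≤ N) (m : ℕ) {y : ℝ → ℝ}
    (hy : ContDiff ℝ (⊤ : ℕ∞) y) {k : ℕ} {B : ℝ}
    (hB : ∀ r ∈ Icc (0 : ℝ) 1, |iteratedDeriv (k + 2 * m) (fun r => y (r ^ 2)) r| ≤ B) {r : ℝ}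
    (hr : r ∈ Icc (0 : ℝ) 1) :
    |iteratedDeriv k (fun r => (lap N)^[m] y (r ^ 2)) r| ≤ N ^ m * B := by
  induction m generalizing y r B with
  | zero => simpa using hB r hr
  | succ m ih =>
    have := ih (contDiff_lap (N := N) hy) (B := N * B)
      (fun r hr => abs_iteratedDeriv_lap_comp_sq_le hN hy hB hr) hr
    rw [pow_succ, mul_assoc]
    exact this

/-- On every interval of length `l`, the `k`-th derivative of a bounded function is somewhere of
size at most `l⁻ᵏ` times the bound. -/
theorem exists_abs_iteratedDeriv_le (k : ℕ) : ∃ C : ℝ, 0 ≤ C ∧ ∀ (u : ℝ → ℝ) (M a l : ℝ),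
    ContDiff ℝ (⊤ : ℕ∞) u → 0 < l → (∀ x ∈ Icc a (a + l), |u x| ≤ M) →
      ∃ p ∈ Icc a (a + l), |iteratedDeriv k u p| * l ^ k ≤ C * M := by
  induction k with
  | zero =>
    refine ⟨1, zero_le_one, fun u M a l _ hl h => ⟨a, ⟨le_rfl, by linarith⟩, ?_⟩⟩
    simpa using h a ⟨le_rfl, by linarith⟩
  | succ k ih =>
    obtain ⟨C, hC, ih⟩ := ih
    refine ⟨2 * 3 ^ (k + 1) * C, by positivity, fun u M a l hu hl h => ?_⟩
    obtain ⟨p, hp, hpC⟩ := ih u M a (l / 3) hu (by linarith)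
      fun x hx => h x ⟨hx.1, by linarith [hx.2]⟩
    obtain ⟨q, hq, hqC⟩ := ih u M (a + 2 * l / 3) (l / 3) hu (by linarith)
      fun x hx => h x ⟨by linarith [hx.1], by linarith [hx.2]⟩
    have hpq : l / 3 ≤ q - p := by linarith [hp.2, hq.1]
    have hs := (contDiff_iteratedDeriv_top hu k).differentiable (by simp)
    obtain ⟨c, hc, hd⟩ := exists_deriv_eq_slope (iteratedDeriv k u) (by linarith : p < q)
      hs.continuous.continuousOn hs.differentiableOn
    refine ⟨c, ⟨by linarith [hc.1, hp.1], by linarith [hc.2, hq.2]⟩, ?_⟩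
    rw [eq_div_iff (by linarith : q - p ≠ 0), ← iteratedDeriv_succ] at hd
    have h1 : |iteratedDeriv (k + 1) u c| * (l / 3) ≤
        |iteratedDeriv k u q| + |iteratedDeriv k u p| := by
      calc _ ≤ |iteratedDeriv (k + 1) u c| * (q - p) := by gcongr
        _ = |iteratedDeriv k u q - iteratedDeriv k u p| := by
          rw [← hd, abs_mul, abs_of_pos (by linarith : 0 < q - p)]
        _ ≤ _ := abs_sub _ _
    have h2 : |iteratedDeriv (k + 1) u c| * (l / 3) * (l / 3) ^ k ≤ 2 * (C * M) := by
      calc _ ≤ (|iteratedDeriv k u q| + |iteratedDeriv k u p|) * (l / 3) ^ k := by gcongr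
        _ ≤ _ := by linarith
    rw [mul_assoc, ← pow_succ', div_pow] at h2
    calc |iteratedDeriv (k + 1) u c| * l ^ (k + 1)
        = 3 ^ (k + 1) * (|iteratedDeriv (k + 1) u c| * (l ^ (k + 1) / 3 ^ (k + 1))) := by
          field_simp
      _ ≤ 3 ^ (k + 1) * (2 * (C * M)) := by gcongr
      _ = _ := by ring

/-- Interpolation of intermediate derivatives on `[0, 1]`, in scaled form. -/
theorem exists_interpolation (M B : ℝ) (n i : ℕ) : ∃ C : ℝ, 0 ≤ C ∧ ∀ (k : ℕ), k + i = n →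
    ∀ (u : ℝ → ℝ) (L : ℝ), ContDiff ℝ (⊤ : ℕ∞) u → 1 ≤ L →
      (∀ x ∈ Icc (0 : ℝ) 1, |u x| ≤ M) →
      (∀ x ∈ Icc (0 : ℝ) 1, |iteratedDeriv n u x| ≤ B * L ^ n) →
      ∀ x ∈ Icc (0 : ℝ) 1, |iteratedDeriv k u x| ≤ C * L ^ k := by
  induction i with
  | zero =>
    refine ⟨|B|, abs_nonneg _, fun k hk u L hu hL _ h x hx => ?_⟩
    obtain rfl : k = n := hk
    exact (h x hx).trans (by gcongr; exact le_abs_self _)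
  | succ i ih =>
    obtain ⟨C, hC, ih⟩ := ih
    obtain ⟨D, hD, hpt⟩ := exists_abs_iteratedDeriv_le (n - (i + 1))
    refine ⟨D * |M| + C, by positivity, fun k hk u L hu hL hM h x hx => ?_⟩
    obtain rfl : k = n - (i + 1) := by omega
    set k := n - (i + 1)
    have hL0 : 0 < L := by linarith
    have hl1 : L⁻¹ ≤ 1 := inv_le_one_of_one_le₀ hL
    have hl0 : 0 < L⁻¹ := by positivity
    obtain ⟨a, ha0, ha1, hax, hxa⟩ : ∃ a : ℝ, 0 ≤ a ∧ a + L⁻¹ ≤ 1 ∧ a ≤ x ∧ x ≤ a + L⁻¹ := by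
      rcases le_total (x + L⁻¹) 1 with h1 | h1
      · exact ⟨x, hx.1, h1, le_rfl, by linarith⟩
      · exact ⟨1 - L⁻¹, by linarith, by linarith, by linarith, by linarith [hx.2]⟩
    obtain ⟨p, hp, hpD⟩ := hpt u M a L⁻¹ hu hl0
      fun x hx => hM x ⟨by linarith [hx.1], by linarith [hx.2]⟩
    have hpD' : |iteratedDeriv k u p| ≤ D * |M| * L ^ k := by
      rw [inv_pow, ← div_eq_mul_inv, div_le_iff₀ (by positivity)] at hpD
      exact hpD.trans (by gcongr; exact le_abs_self _)
    have hbd := ih (k + 1) (by omega) u L hu hL hM h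
    have hs := (contDiff_iteratedDeriv_top hu k).differentiable (by simp)
    have hlip := (convex_Icc (0 : ℝ) 1).norm_image_sub_le_of_norm_deriv_le
      (f := iteratedDeriv k u) (C := C * L ^ (k + 1)) (fun x _ => hs x)
      (fun x hx => by rw [← iteratedDeriv_succ]; exact hbd x hx)
      (⟨by linarith [hp.1], by linarith [hp.2]⟩ : p ∈ Icc (0 : ℝ) 1) hx
    rw [Real.norm_eq_abs, Real.norm_eq_abs] at hlip
    have hxp : |x - p| ≤ L⁻¹ := abs_le.2 ⟨by linarith [hp.2], by linarith [hp.1]⟩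
    calc |iteratedDeriv k u x|
        ≤ |iteratedDeriv k u p| + |iteratedDeriv k u x - iteratedDeriv k u p| := by
          simpa using abs_add_le (iteratedDeriv k u p) (iteratedDeriv k u x - iteratedDeriv k u p)
      _ ≤ D * |M| * L ^ k + C * L ^ (k + 1) * L⁻¹ := by
          gcongr
          exact hlip.trans (by gcongr)
      _ = _ := by
          field_simp
          ring

theorem exists_interpolation_uniform (M B : ℝ) (n : ℕ) : ∃ C : ℝ, 0 ≤ C ∧
    ∀ (u : ℝ → ℝ) (L : ℝ), ContDiff ℝ (⊤ : ℕ∞) u → 1 ≤ L →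
      (∀ x ∈ Icc (0 : ℝ) 1, |u x| ≤ M) →
      (∀ x ∈ Icc (0 : ℝ) 1, |iteratedDeriv n u x| ≤ B * L ^ n) →
      ∀ k ≤ n, ∀ x ∈ Icc (0 : ℝ) 1, |iteratedDeriv k u x| ≤ C * L ^ k := by
  choose C hC h using exists_interpolation M B n
  refine ⟨∑ i ∈ Finset.range (n + 1), C i, Finset.sum_nonneg fun i _ => hC i,
    fun u L hu hL hM hB k hk x hx => ?_⟩
  refine (h (n - k) k (by omega) u L hu hL hM hB x hx).trans ?_
  gcongr
  exact Finset.single_le_sum (fun i _ => hC i) (Finset.mem_range.2 (by omega))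

theorem deriv_comp_graph {G : ℝ × ℝ → ℝ} (hG : ContDiff ℝ (⊤ : ℕ∞) G) {u : ℝ → ℝ}
    (hu : ContDiff ℝ (⊤ : ℕ∞) u) :
    deriv (fun r => G (r, u r)) =
      (fun r => fderiv ℝ G (r, u r) (1, 0)) + (fun r => fderiv ℝ G (r, u r) (0, 1)) * deriv u := by
  funext r
  have d0 : HasDerivAt u (deriv u r) r := (hu.differentiable (by simp) r).hasDerivAt
  have d1 := (hG.differentiable (by simp) (r, u r)).hasFDerivAt.comp_hasDerivAt r
    ((hasDerivAt_id r).prodMk d0)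
  refine d1.deriv.trans ?_
  have : ((1 : ℝ), deriv u r) = (1, 0) + deriv u r • (0, 1) := by simp
  rw [this, map_add, map_smul]
  simp [mul_comm]

/-- Composition estimate: if `u` is bounded and its derivatives up to order `n` scale like powers
of `L`, then so do those of `r ↦ G (r, u r)`. -/
theorem exists_comp_bound (M C : ℝ) (n k : ℕ) : k ≤ n →
    ∀ G : ℝ × ℝ → ℝ, ContDiff ℝ (⊤ : ℕ∞) G →
    ∃ D : ℝ, 0 ≤ D ∧ ∀ (u : ℝ → ℝ) (L : ℝ), ContDiff ℝ (⊤ : ℕ∞) u → 1 ≤ L →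
      (∀ x ∈ Icc (0 : ℝ) 1, |u x| ≤ M) →
      (∀ k ≤ n, ∀ x ∈ Icc (0 : ℝ) 1, |iteratedDeriv k u x| ≤ C * L ^ k) →
      ∀ x ∈ Icc (0 : ℝ) 1, |iteratedDeriv k (fun r => G (r, u r)) x| ≤ D * L ^ k := by
  induction k using Nat.strong_induction_on with
  | _ k ih =>
  intro hk G hG
  rcases k with _ | k
  · obtain ⟨D, hD⟩ := (isCompact_Icc.prod isCompact_Icc : IsCompact
      (Icc (0 : ℝ) 1 ×ˢ Icc (-M) M)).exists_bound_of_continuousOn hG.continuous.continuousOn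
    refine ⟨|D|, abs_nonneg _, fun u L hu hL hM _ x hx => ?_⟩
    simpa using (hD (x, u x) ⟨hx, abs_le.1 (hM x hx)⟩).trans (le_abs_self D)
  · have hG' : ContDiff ℝ (⊤ : ℕ∞) (fderiv ℝ G) := hG.fderiv_right (by simp)
    have hG1 : ContDiff ℝ (⊤ : ℕ∞) fun p => fderiv ℝ G p (1, 0) := hG'.clm_apply contDiff_const
    have hG2 : ContDiff ℝ (⊤ : ℕ∞) fun p => fderiv ℝ G p (0, 1) := hG'.clm_apply contDiff_const
    obtain ⟨D₁, hD₁, h₁⟩ := ih k (by omega) (by omega) _ hG1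
    have h₂ : ∀ j : ℕ, ∃ D : ℝ, 0 ≤ D ∧ (j ≤ k → ∀ (u : ℝ → ℝ) (L : ℝ),
        ContDiff ℝ (⊤ : ℕ∞) u → 1 ≤ L → (∀ x ∈ Icc (0 : ℝ) 1, |u x| ≤ M) →
        (∀ k ≤ n, ∀ x ∈ Icc (0 : ℝ) 1, |iteratedDeriv k u x| ≤ C * L ^ k) →
        ∀ x ∈ Icc (0 : ℝ) 1,
          |iteratedDeriv j (fun r => fderiv ℝ G (r, u r) (0, 1)) x| ≤ D * L ^ j) := by
      intro j
      by_cases hj : j ≤ k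
      · obtain ⟨D, hD, h⟩ := ih j (by omega) (by omega) _ hG2
        exact ⟨D, hD, fun _ => h⟩
      · exact ⟨0, le_rfl, fun h => absurd h hj⟩
    choose D₂ hD₂ h₂ using h₂
    refine ⟨D₁ + ∑ j ∈ Finset.range (k + 1), k.choose j * D₂ j * |C|, add_nonneg hD₁
      (Finset.sum_nonneg fun j _ => mul_nonneg (mul_nonneg (by positivity) (hD₂ j))
        (abs_nonneg _)), fun u L hu hL hM hC x hx => ?_⟩
    have hL0 : 0 < L := by linarith
    have hc1 : ContDiff ℝ (⊤ : ℕ∞) fun r => fderiv ℝ G (r, u r) (1, 0) :=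
      hG1.comp (contDiff_id.prodMk hu)
    have hc2 : ContDiff ℝ (⊤ : ℕ∞) fun r => fderiv ℝ G (r, u r) (0, 1) :=
      hG2.comp (contDiff_id.prodMk hu)
    have hu' := contDiff_deriv_top hu
    have hle : (k : WithTop ℕ∞) ≤ ((⊤ : ℕ∞) : WithTop ℕ∞) := by exact_mod_cast le_top
    have hmul : ContDiff ℝ k ((fun r => fderiv ℝ G (r, u r) (0, 1)) * deriv u) :=
      (hc2.mul hu').of_le hle
    rw [iteratedDeriv_succ', deriv_comp_graph hG hu,
      iteratedDeriv_add (hc1.of_le hle).contDiffAt hmul.contDiffAt,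
      iteratedDeriv_mul (hc2.of_le hle).contDiffAt (hu'.of_le hle).contDiffAt, add_mul,
      Finset.sum_mul]
    refine (abs_add_le _ _).trans (add_le_add ?_ ?_)
    · refine (h₁ u L hu hL hM hC x hx).trans ?_
      gcongr
      omega
    · refine (Finset.abs_sum_le_sum_abs _ _).trans (Finset.sum_le_sum fun j hj => ?_)
      have hj : j ≤ k := Nat.lt_succ_iff.1 (Finset.mem_range.1 hj)
      rw [abs_mul, abs_mul, Nat.abs_cast, ← iteratedDeriv_succ']
      have e1 := h₂ j hj u L hu hL hM hC x hx
      have e2 : |iteratedDeriv (k - j + 1) u x| ≤ |C| * L ^ (k - j + 1) :=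
        (hC _ (by omega) x hx).trans (by gcongr; exact le_abs_self _)
      calc _ ≤ k.choose j * (D₂ j * L ^ j) * (|C| * L ^ (k - j + 1)) := by
            have := hD₂ j
            gcongr
        _ = k.choose j * D₂ j * |C| * (L ^ j * L ^ (k - j + 1)) := by ring
        _ = _ := by rw [← pow_add]; congr 2; omega

theorem stmt_12 (N : ℝ) (hN : 2 ≤ N) (F : ℝ → ℝ → ℝ)
    (hF : ContDiff ℝ (⊤ : ℕ∞) (Function.uncurry F)) (M : ℝ) (hM : 0 < M)
    (m : ℕ) (hm : 1 ≤ m) :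
    ∃ C > 0, ∀ y : ℝ → ℝ, ContDiff ℝ (⊤ : ℕ∞) y → supNorm y ≤ M →
      supNorm ((lap N)^[m] (fun x => F x (y x))) ≤
        C * (1 + ⨆ j : Finset.range (m + 1), supNorm ((lap N)^[(j : ℕ)] y)) := by
  have hN1 : 1 ≤ N := by linarith
  obtain ⟨C, hC, hint⟩ := exists_interpolation_uniform M ((4 * N) ^ m) (2 * m)
  obtain ⟨D, hD, hcomp⟩ := exists_comp_bound M C (2 * m) (2 * m) le_rfl
    (fun p => uncurry F (p.1 ^ 2, p.2)) (hF.comp (by fun_prop))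
  refine ⟨N ^ m * D + 1, by positivity, fun y hy hyM => ?_⟩
  set K := ⨆ j : Finset.range (m + 1), supNorm ((lap N)^[(j : ℕ)] y)
  have hmK : supNorm ((lap N)^[m] y) ≤ K :=
    le_ciSup (f := fun j : Finset.range (m + 1) => supNorm ((lap N)^[(j : ℕ)] y))
      (finite_range _).bddAbove ⟨m, by simp⟩
  have hsq : ∀ r ∈ Icc (0 : ℝ) 1, r ^ 2 ∈ Icc (0 : ℝ) 1 := fun r hr =>
    ⟨sq_nonneg r, pow_le_one₀ hr.1 hr.2⟩
  have hlap : ∀ x ∈ Icc (0 : ℝ) 1, |(lap N)^[m] y x| ≤ K := fun x hx =>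
    (abs_le_supNorm (contDiff_lap_iterate hy m).continuous hx).trans hmK
  have hK0 : 0 ≤ K := (abs_nonneg _).trans (hlap 0 (by simp))
  set L : ℝ := (1 + K) ^ (((2 * m : ℕ) : ℝ)⁻¹)
  have hL : 1 ≤ L := Real.one_le_rpow (by linarith) (by positivity)
  have hLK : L ^ (2 * m) = 1 + K := Real.rpow_inv_natCast_pow (by linarith) (by omega)
  have hu := contDiff_comp_sq hy
  have huM : ∀ r ∈ Icc (0 : ℝ) 1, |y (r ^ 2)| ≤ M := fun r hr =>
    (abs_le_supNorm hy.continuous (hsq r hr)).trans hyM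
  have hud : ∀ r ∈ Icc (0 : ℝ) 1,
      |iteratedDeriv (2 * m) (fun r => y (r ^ 2)) r| ≤ (4 * N) ^ m * L ^ (2 * m) := by
    intro r hr
    have := abs_iteratedDeriv_comp_sq_le_of_iterate hN1 m hy (k := 0) (B := 1 + K)
      (fun r hr => by
        simpa using (hlap _ (hsq r hr)).trans (by linarith)) hr
    rwa [zero_add, ← hLK] at this
  have hw := hcomp _ L hu hL huM (hint _ L hu hL huM hud)
  have hFy : ContDiff ℝ (⊤ : ℕ∞) fun x => F x (y x) := hF.comp (contDiff_id.prodMk hy)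
  refine supNorm_le fun x hx => ?_
  have := abs_iteratedDeriv_lap_iterate_comp_sq_le hN1 m hFy (k := 0) (B := D * L ^ (2 * m))
    (by rw [zero_add]; exact hw) (r := √x)
    ⟨Real.sqrt_nonneg x, Real.sqrt_le_one.2 hx.2⟩
  rw [iteratedDeriv_zero, Real.sq_sqrt hx.1, hLK] at this
  linarith
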